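/- There exists an absolute constant C such that for every real t ≥ 1, every connected weighted graph G on n ≥ 2 vertices with positive edge weights has a spanner H with at most n + n/t edges and stretch at most C·t·(log n)·4^{log* n}. -/

import Mathlib

open SimpleGraph

/-- Weighted shortest-path distance in a graph `G` with edge weights `w`
(`⊤` if `u` and `v` are not connected). For `w = fun _ => 1` this is the hop distance. -/
noncomputable def wdist {V : Type*} (G : SimpleGraph V) (w : Sym2 V → NNReal) (u v : V) :
    ENNReal :=
  ⨅ p : G.Walk u v, ((p.edges.map w).sum : ENNReal)

/-- `H` is an `α`-spanner of the weighted graph `(G, w)`: `H` is a subgraph of `G` and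
all pairwise distances are stretched by a factor of at most `α`. -/
def IsSpanner {V : Type*} (G H : SimpleGraph V) (w : Sym2 V → NNReal) (α : ℝ) : Prop :=
  H ≤ G ∧ ∀ u v : V, wdist H w u v ≤ ENNReal.ofReal α * wdist G w u v


/-- The iterated (base-2) logarithm: the number of times `logb 2` must be applied to `x`
before the result becomes at most `1`. -/
noncomputable def logStar (x : ℝ) : ℕ :=
  sInf {k : ℕ | (Real.logb 2)^[k] x ≤ 1}

namespace SimpleGraph

variable {V : Type*}

/-- Every subgraph of `G` with at most `L` edges is a forest, i.e. `G` has girth greater than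
`L`. -/
def AcyclicUpTo (G : SimpleGraph V) (L : ℕ) : Prop :=
  ∀ F ≤ G, F.edgeSet.ncard ≤ L → F.IsAcyclic

lemma AcyclicUpTo.anti {G K : SimpleGraph V} {L : ℕ} (hG : G.AcyclicUpTo L) (h : K ≤ G) :
    K.AcyclicUpTo L := fun F hF ↦ hG F (hF.trans h)

lemma AcyclicUpTo.sup_edge [Finite V] {G : SimpleGraph V} {L : ℕ} {u v : V}
    (hG : G.AcyclicUpTo (L + 1)) (huv : ∀ p : G.Walk u v, L < p.length) :
    (G ⊔ edge u v).AcyclicUpTo (L + 1) := by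
  classical
  intro F hF hcard
  have hle : F.deleteEdges {s(u, v)} ≤ G := by
    intro a b hab
    rw [deleteEdges_adj] at hab
    have := hF hab.1
    rw [sup_adj, edge_adj] at this
    grind
  by_cases he : s(u, v) ∈ F.edgeSet
  · have hcard' : (F.deleteEdges {s(u, v)}).edgeSet.ncard ≤ L := by
      rw [edgeSet_deleteEdges, Set.ncard_sdiff_singleton_of_mem he]
      omega
    have hacyc := hG _ hle (by omega)
    have hreach : ¬ (F.deleteEdges {s(u, v)}).Reachable u v := by
      rintro ⟨p⟩
      have h1 := huv (p.bypass.mapLe hle)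
      have h2 : p.bypass.length ≤ (F.deleteEdges {s(u, v)}).edgeSet.ncard := by
        rw [← Walk.length_edges,
          ← List.toFinset_card_of_nodup p.bypass_isPath.isTrail.edges_nodup, ← Set.ncard_coe_finset]
        refine Set.ncard_le_ncard (fun e he ↦ ?_) (Set.toFinite _)
        exact p.bypass.edges_subset_edgeSet (by simpa using he)
      rw [Walk.length_mapLe] at h1
      omega
    refine (hacyc.sup_edge_of_not_reachable hreach).anti fun a b hab ↦ ?_
    rw [sup_adj, edge_adj, deleteEdges_adj]
    have := hab.ne
    grind
  · refine hG F ?_ hcard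
    rwa [deleteEdges_eq_self.mpr (by simpa using he)] at hle

/-- The greedy spanner: a subgraph of high girth in which every edge of `G` is replaced by a walk
with few edges, none of which is heavier. -/
theorem exists_greedy_subgraph [Finite V] (G : SimpleGraph V) (w : Sym2 V → NNReal) (L : ℕ) :
    ∃ H ≤ G, H.AcyclicUpTo (L + 1) ∧ ∀ u v, G.Adj u v →
      ∃ p : H.Walk u v, p.length ≤ L ⊔ 1 ∧ ∀ e ∈ p.edges, w e ≤ w s(u, v) := by
  classical
  have key : ∀ S : Finset (Sym2 V), ∃ H : SimpleGraph V, H.edgeSet ⊆ S ∧ H.AcyclicUpTo (L + 1) ∧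
      ∀ u v, u ≠ v → s(u, v) ∈ S →
        ∃ p : H.Walk u v, p.length ≤ L ⊔ 1 ∧ ∀ e ∈ p.edges, w e ≤ w s(u, v) := by
    intro S
    induction S using Finset.induction_on_max_value w with
    | empty =>
      exact ⟨⊥, by simp, fun F hF _ ↦ isAcyclic_bot.anti hF, by simp⟩
    | insert a S _ hmax ih =>
      obtain ⟨H, hHS, hH, hcov⟩ := ih
      induction a with | _ x y =>
      by_cases hxy : ∃ p : H.Walk x y, p.length ≤ L
      · obtain ⟨p, hp⟩ := hxy
        have hpw : ∀ e ∈ p.edges, w e ≤ w s(x, y) := fun e he ↦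
          hmax e (by simpa using hHS (p.edges_subset_edgeSet he))
        refine ⟨H, hHS.trans (by simp), hH, fun u v huv he ↦ ?_⟩
        rcases Finset.mem_insert.mp he with he | he
        · rcases Sym2.eq_iff.mp he with ⟨rfl, rfl⟩ | ⟨rfl, rfl⟩
          · exact ⟨p, by omega, hpw⟩
          · exact ⟨p.reverse, by simp; omega, by simpa [Sym2.eq_swap] using hpw⟩
        · exact hcov u v huv he
      · push Not at hxy
        refine ⟨H ⊔ edge x y, ?_, hH.sup_edge hxy, fun u v huv he ↦ ?_⟩
        · rw [edgeSet_sup, Finset.coe_insert]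
          refine Set.union_subset (hHS.trans (Set.subset_insert _ _)) ?_
          intro e he
          rw [edge, edgeSet_fromEdgeSet] at he
          exact Or.inl he.1
        · rcases Finset.mem_insert.mp he with he | he
          · have hadj : (H ⊔ edge x y).Adj u v := by
              rw [sup_adj, edge_adj]
              have := Sym2.eq_iff.mp he
              grind
            exact ⟨hadj.toWalk, by simp, by simp⟩
          · obtain ⟨p, hp, hpw⟩ := hcov u v huv he
            exact ⟨p.mapLe le_sup_left, by simpa using hp, by simpa using hpw⟩
  obtain ⟨H, hHS, hH, hcov⟩ := key (Set.toFinite G.edgeSet).toFinset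
  exact ⟨H, edgeSet_subset_edgeSet.mp (by simpa using hHS), hH,
    fun u v huv ↦ hcov u v huv.ne (by simpa using huv)⟩

lemma Walk.penultimate_transfer {G F : SimpleGraph V} {u v : V} (p : G.Walk u v)
    (hp : ∀ e ∈ p.edges, e ∈ F.edgeSet) : (p.transfer F hp).penultimate = p.penultimate := by
  simp [← Walk.support_getElem_length_sub_one_eq_penultimate]

lemma AcyclicUpTo.eq_penultimate_or_eq_penultimate [Finite V] {G : SimpleGraph V} {L : ℕ}
    (hG : G.AcyclicUpTo L) {v x y : V} {p : G.Walk v x} {q : G.Walk v y} (hp : p.IsPath)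
    (hq : q.IsPath) (hL : p.length + q.length + 1 ≤ L) (hxy : G.Adj x y) :
    y = p.penultimate ∨ x = q.penultimate := by
  classical
  let l : List (Sym2 V) := s(x, y) :: (p.edges ++ q.edges)
  have hl : ∀ e ∈ l, e ∈ G.edgeSet := by
    intro e he
    simp only [l, List.mem_cons, List.mem_append] at he
    rcases he with rfl | he | he
    · exact hxy
    · exact p.edges_subset_edgeSet he
    · exact q.edges_subset_edgeSet he
  let F : SimpleGraph V := fromEdgeSet {e | e ∈ l}
  have hF : ∀ e ∈ l, e ∈ F.edgeSet := fun e he ↦ by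
    rw [edgeSet_fromEdgeSet]
    exact ⟨he, not_isDiag_of_mem_edgeSet _ (hl e he)⟩
  have hFG : F ≤ G := by
    intro a b hab
    exact hl _ ((fromEdgeSet_adj _).mp hab).1
  have hacyc : F.IsAcyclic := by
    refine hG F hFG (le_trans ?_ hL)
    calc F.edgeSet.ncard ≤ (l.toFinset : Set (Sym2 V)).ncard := by
          refine Set.ncard_le_ncard (fun e he ↦ ?_) (Set.toFinite _)
          rw [edgeSet_fromEdgeSet] at he
          simpa using he.1
      _ = l.toFinset.card := Set.ncard_coe_finset _
      _ ≤ l.length := l.toFinset_card_le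
      _ = p.length + q.length + 1 := by simp [l]
  have hpF : ∀ e ∈ p.edges, e ∈ F.edgeSet := fun e he ↦ hF e (by simp [l, he])
  have hqF : ∀ e ∈ q.edges, e ∈ F.edgeSet := fun e he ↦ hF e (by simp [l, he])
  have hxyF : F.Adj x y := hF s(x, y) (by simp [l])
  by_cases hy : y ∈ p.support
  · left
    rw [← p.penultimate_transfer hpF]
    exact hacyc.eq_penultimate_of_adj_end (hp.transfer hpF) hxyF (by simpa using hy)
  · right
    rw [← q.penultimate_transfer hqF]
    refine hacyc.eq_penultimate_of_adj_end (hq.transfer hqF) hxyF.symm ?_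
    exact hacyc.mem_support_of_ne_mem_support_of_adj_of_isPath (hq.transfer hqF)
      (hp.transfer hpF) hxyF.symm (by simpa using hy)

section Ball

variable [Fintype V]

open Classical in
/-- The vertices joined to `v` by a walk with at most `r` edges. -/
noncomputable def hopBall (G : SimpleGraph V) (v : V) (r : ℕ) : Finset V :=
  {x | ∃ p : G.Walk v x, p.length ≤ r}

lemma mem_hopBall {G : SimpleGraph V} {v x : V} {r : ℕ} :
    x ∈ G.hopBall v r ↔ ∃ p : G.Walk v x, p.length ≤ r := by
  simp [hopBall]

lemma self_mem_hopBall (G : SimpleGraph V) (v : V) (r : ℕ) : v ∈ G.hopBall v r :=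
  mem_hopBall.mpr ⟨.nil, by simp⟩

open Classical in
/-- Edges touching a ball inject into the next ball by taking the endpoint further away. -/
lemma AcyclicUpTo.card_touching_hopBall_le {G : SimpleGraph V} [Fintype G.edgeSet] {L r : ℕ}
    (hG : G.AcyclicUpTo L) (hr : 2 * r + 3 ≤ L) (v : V) :
    (G.edgeFinset.filter (fun e ↦ ∃ x ∈ e, x ∈ G.hopBall v r)).card
      ≤ (G.hopBall v (r + 1)).card := by
  have hparent : ∀ x ∈ G.hopBall v (r + 1), ∃ z, ∃ p : G.Walk v x,
      p.IsPath ∧ p.length ≤ r + 1 ∧ z = p.penultimate := by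
    intro x hx
    obtain ⟨p, hp⟩ := mem_hopBall.mp hx
    exact ⟨_, p.bypass, p.bypass_isPath, p.length_bypass_le_length.trans hp, rfl⟩
  have : Nonempty V := ⟨v⟩
  choose! parent hparent using hparent
  refine (Finset.card_le_card ?_).trans
    (Finset.card_image_le (f := fun x ↦ s(parent x, x)))
  intro e he
  rw [Finset.mem_filter, mem_edgeFinset] at he
  obtain ⟨hadj, x, hxe, hx⟩ := he
  obtain ⟨y, rfl⟩ := Sym2.mem_iff_exists.mp hxe
  rw [mem_edgeSet] at hadj
  obtain ⟨p, hp⟩ := mem_hopBall.mp hx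
  have hx' : x ∈ G.hopBall v (r + 1) := mem_hopBall.mpr ⟨p, by omega⟩
  have hy' : y ∈ G.hopBall v (r + 1) := mem_hopBall.mpr ⟨p.concat hadj, by simpa using hp⟩
  obtain ⟨p', hp', hlen, hpar⟩ := hparent x hx'
  obtain ⟨q', hq', hlen', hpar'⟩ := hparent y hy'
  rw [Finset.mem_image]
  rcases hG.eq_penultimate_or_eq_penultimate hp' hq' (by omega) hadj with h | h
  · exact ⟨x, hx', by rw [hpar, ← h, Sym2.eq_swap]⟩
  · exact ⟨y, hy', by rw [hpar', ← h]⟩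

open Classical in
/-- A graph of average degree greater than `2 (1 + ε)` and large girth has exponentially many
vertices. -/
theorem AcyclicUpTo.pow_le_card {G : SimpleGraph V} {R : ℕ} {ε : ℝ} (hε : 0 ≤ ε)
    (hG : G.AcyclicUpTo (2 * R + 1))
    (hcard : (1 + ε) * Fintype.card V < G.edgeSet.ncard) :
    (1 + ε) ^ R ≤ Fintype.card V := by
  let P : Finset V → Prop := fun S ↦
    (1 + ε) * S.card < ((G.edgeFinset.filter (fun e ↦ ∀ x ∈ e, x ∈ S)).card : ℝ)
  have hP : P Finset.univ := by
    simpa [P, ← coe_edgeFinset, Set.ncard_coe_finset] using hcard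
  obtain ⟨S, hS⟩ := exists_minimal_of_wellFoundedLT P ⟨_, hP⟩
  have hSne : S.Nonempty := by
    rw [Finset.nonempty_iff_ne_empty]
    rintro rfl
    have h := hS.prop
    have hempty : G.edgeFinset.filter (fun e ↦ ∀ x ∈ e, x ∈ (∅ : Finset V)) = ∅ := by
      refine Finset.filter_eq_empty_iff.mpr fun e _ h ↦ ?_
      induction e with | _ a b => simpa using h a (by simp)
    simp only [P, hempty] at h
    simp at h
  obtain ⟨v, hv⟩ := hSne
  let K : SimpleGraph V :=
    { Adj := fun a b ↦ G.Adj a b ∧ a ∈ S ∧ b ∈ S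
      symm := ⟨fun _ _ h ↦ ⟨h.1.symm, h.2.2, h.2.1⟩⟩
      loopless := ⟨fun _ h ↦ h.1.ne rfl⟩ }
  have hK : K.edgeFinset = G.edgeFinset.filter (fun e ↦ ∀ x ∈ e, x ∈ S) := by
    ext e
    induction e with | _ a b => simp [K]
  have hKG : K.AcyclicUpTo (2 * R + 1) := hG.anti fun _ _ h ↦ h.1
  have hsub : ∀ r, K.hopBall v r ⊆ S := by
    intro r x hx
    obtain ⟨p, -⟩ := mem_hopBall.mp hx
    clear hx
    induction p with
    | nil => exact hv
    | cons h p ih => exact ih h.2.2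
  have hgrow : ∀ r, r + 1 ≤ R →
      (1 + ε) * (K.hopBall v r).card ≤ ((K.hopBall v (r + 1)).card : ℝ) := by
    intro r hr
    set B := K.hopBall v r with hB
    have hnot : ¬ P (S \ B) := by
      intro h
      have := hS.le_of_le h Finset.sdiff_subset (self_mem_hopBall K v r |> hsub r)
      exact (Finset.mem_sdiff.mp this).2 (self_mem_hopBall K v r)
    have htouch := hKG.card_touching_hopBall_le (r := r) (by omega) v
    rw [hK, Finset.filter_filter, ← hB] at htouch
    have hsplit : (G.edgeFinset.filter (fun e ↦ ∀ x ∈ e, x ∈ S)).card ≤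
        (G.edgeFinset.filter (fun e ↦ ∀ x ∈ e, x ∈ S \ B)).card +
        (G.edgeFinset.filter (fun e ↦ (∀ x ∈ e, x ∈ S) ∧ ∃ x ∈ e, x ∈ B)).card := by
      refine (Finset.card_le_card ?_).trans (Finset.card_union_le _ _)
      intro e he
      simp only [Finset.mem_union, Finset.mem_filter, Finset.mem_sdiff] at he ⊢
      by_cases h : ∃ x ∈ e, x ∈ B
      · exact Or.inr ⟨he.1, he.2, h⟩
      · push Not at h
        exact Or.inl ⟨he.1, fun x hx ↦ ⟨he.2 x hx, h x hx⟩⟩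
    have h1 := hS.prop
    have h2 : ((S \ B).card : ℝ) = S.card - B.card := Finset.cast_card_sdiff (hsub r)
    simp only [P, h2, not_lt] at h1 hnot
    have h3 : ((G.edgeFinset.filter (fun e ↦ ∀ x ∈ e, x ∈ S)).card : ℝ) ≤
        (G.edgeFinset.filter (fun e ↦ ∀ x ∈ e, x ∈ S \ B)).card + (K.hopBall v (r + 1)).card := by
      exact_mod_cast hsplit.trans (by gcongr)
    linarith
  have hpow : ∀ r ≤ R, (1 + ε) ^ r ≤ ((K.hopBall v r).card : ℝ) := by
    intro r
    induction r with
    | zero =>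
      intro _
      simpa [Finset.one_le_card] using ⟨v, self_mem_hopBall K v 0⟩
    | succ r ih =>
      intro hr
      calc (1 + ε) ^ (r + 1) = (1 + ε) * (1 + ε) ^ r := pow_succ' _ _
        _ ≤ (1 + ε) * (K.hopBall v r).card := by gcongr; exact ih (by omega)
        _ ≤ _ := hgrow r hr
  exact (hpow R le_rfl).trans (by exact_mod_cast Finset.card_le_univ _)

end Ball

end SimpleGraph

variable {V : Type*}

lemma wdist_triangle (G : SimpleGraph V) (w : Sym2 V → NNReal) (a b c : V) :
    wdist G w a c ≤ wdist G w a b + wdist G w b c := by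
  simp only [wdist]
  refine ENNReal.le_iInf_add_iInf fun p q ↦ ?_
  refine (iInf_le _ (p.append q)).trans ?_
  simp

/-- Replacing every edge by a walk of bounded weight yields a spanner. -/
lemma isSpanner_of_forall_adj {G H : SimpleGraph V} {w : Sym2 V → NNReal} {α : ℝ} (hα : 0 < α) (hHG : H ≤ G)
    (h : ∀ u v, G.Adj u v → wdist H w u v ≤ ENNReal.ofReal α * w s(u, v)) :
    IsSpanner G H w α := by
  refine ⟨hHG, fun u v ↦ ?_⟩
  have key : ∀ p : G.Walk u v,
      wdist H w u v ≤ ENNReal.ofReal α * ((p.edges.map w).sum : ENNReal) := by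
    intro p
    induction p with
    | nil => exact (iInf_le _ .nil).trans (by simp)
    | @cons a b c hab p ih =>
      refine (wdist_triangle H w a b c).trans ?_
      rw [Walk.edges_cons, List.map_cons, List.sum_cons, ENNReal.coe_add, mul_add]
      exact add_le_add (h a b hab) ih
  rw [wdist.eq_1 G, ENNReal.mul_iInf_of_ne (by simpa using hα) ENNReal.ofReal_ne_top]
  exact le_iInf key

lemma IsSpanner.mono {G H : SimpleGraph V} {w : Sym2 V → NNReal} {α β : ℝ}
    (h : IsSpanner G H w α) (hαβ : α ≤ β) : IsSpanner G H w β :=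
  ⟨h.1, fun u v ↦ (h.2 u v).trans (by gcongr)⟩

/-- Every weighted graph has a spanner of stretch `2 R` and at most `(1 + ε) n` edges, provided
`n < (1 + ε) ^ R`. -/
theorem exists_isSpanner_of_card_lt_pow [Fintype V] (G : SimpleGraph V) (w : Sym2 V → NNReal)
    {R : ℕ} (hR : 1 ≤ R) {ε : ℝ} (hε : 0 ≤ ε) (hn : Fintype.card V < (1 + ε) ^ R) :
    ∃ H, IsSpanner G H w (2 * R) ∧ (H.edgeSet.ncard : ℝ) ≤ (1 + ε) * Fintype.card V := by
  obtain ⟨H, hHG, hH, hcov⟩ := G.exists_greedy_subgraph w (2 * R)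
  refine ⟨H, isSpanner_of_forall_adj (by positivity) hHG fun u v huv ↦ ?_, ?_⟩
  · obtain ⟨p, hp, hpw⟩ := hcov u v huv
    refine (iInf_le _ p).trans ?_
    have hsum : (p.edges.map w).sum ≤ ((2 * R : ℕ) : NNReal) * w s(u, v) := by
      calc (p.edges.map w).sum ≤ (p.edges.map w).length • w s(u, v) :=
            List.sum_le_card_nsmul _ _ (by simpa using hpw)
        _ ≤ (2 * R) • w s(u, v) := by
            refine nsmul_le_nsmul_left zero_le ?_
            simp only [List.length_map, Walk.length_edges]
            omega
        _ = _ := nsmul_eq_mul _ _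
    have hα : ENNReal.ofReal (2 * (R : ℝ)) = ((2 * R : ℕ) : ENNReal) := by
      rw [← ENNReal.ofReal_natCast]
      push_cast
      rfl
    rw [hα]
    exact_mod_cast hsum
  · by_contra! hlt
    exact (hH.pow_le_card hε hlt).not_gt hn

lemma card_lt_one_add_inv_pow {t : ℝ} (ht : 1 ≤ t) {n R : ℕ} (hn : 2 ≤ n)
    (hR : t * Real.logb 2 n + 1 ≤ R) : (n : ℝ) < (1 + 1 / t) ^ R := by
  have ht0 : 0 < t := by linarith
  have hn0 : (0 : ℝ) < n := by positivity
  have hbase : 1 < 1 + 1 / t := by have : 0 < 1 / t := by positivity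
                                   linarith
  have hlog : 0 ≤ Real.logb 2 n := Real.logb_nonneg (by norm_num) (by exact_mod_cast by omega)
  have h2 : 2 ≤ (1 + 1 / t) ^ t := by
    have := one_add_mul_self_le_rpow_one_add (s := 1 / t) (by have : 0 < 1 / t := by positivity
                                                              linarith) ht
    rwa [mul_one_div_cancel ht0.ne', one_add_one_eq_two] at this
  calc (n : ℝ) = 2 ^ Real.logb 2 n := (Real.rpow_logb (by norm_num) (by norm_num) hn0).symm
    _ ≤ ((1 + 1 / t) ^ t) ^ Real.logb 2 n := by gcongr
    _ = (1 + 1 / t) ^ (t * Real.logb 2 n) := (Real.rpow_mul (by positivity) _ _).symm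
    _ < (1 + 1 / t) ^ (R : ℝ) := Real.rpow_lt_rpow_of_exponent_lt hbase (by linarith)
    _ = _ := Real.rpow_natCast _ _

/-- for every real `t ≥ 1`, every connected weighted graph on `n ≥ 2`
vertices with positive edge weights has an ultra-sparse spanner with at most `n + n/t`
edges and stretch `O(t · log n · 4^(log* n))`. -/
theorem exists_ultrasparse_spanner_weighted :
    ∃ C : ℝ, 0 < C ∧
      ∀ (t : ℝ), 1 ≤ t →
        ∀ (n : ℕ), 2 ≤ n →
          ∀ (G : SimpleGraph (Fin n)) (w : Sym2 (Fin n) → NNReal),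
            G.Connected → (∀ e ∈ G.edgeSet, 0 < w e) →
            ∃ H : SimpleGraph (Fin n),
              IsSpanner G H w (C * t * Real.logb 2 n * (4 : ℝ) ^ logStar (n : ℝ)) ∧
              (H.edgeSet.ncard : ℝ) ≤ n + n / t := by
  refine ⟨6, by norm_num, fun t ht n hn G w _ _ ↦ ?_⟩
  have hlog : 1 ≤ Real.logb 2 n := by
    rw [Real.le_logb_iff_rpow_le (by norm_num) (by positivity)]
    exact_mod_cast hn
  have htlog : 1 ≤ t * Real.logb 2 n := one_le_mul_of_one_le_of_one_le ht hlog
  let R : ℕ := ⌈t * Real.logb 2 n⌉₊ + 1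
  have hR : t * Real.logb 2 n + 1 ≤ R := by
    push_cast [R]
    linarith [Nat.le_ceil (t * Real.logb 2 n)]
  have hR' : (R : ℝ) ≤ t * Real.logb 2 n + 2 := by
    push_cast [R]
    linarith [Nat.ceil_lt_add_one (show 0 ≤ t * Real.logb 2 n by linarith)]
  obtain ⟨H, hH, hcard⟩ := exists_isSpanner_of_card_lt_pow G w (R := R) (ε := 1 / t)
    (Nat.le_add_left 1 _) (by positivity) (by simpa using card_lt_one_add_inv_pow ht hn hR)
  refine ⟨H, hH.mono ?_, hcard.trans_eq ?_⟩
  · calc 2 * (R : ℝ) ≤ 6 * t * Real.logb 2 n := by linarith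
      _ ≤ 6 * t * Real.logb 2 n * 4 ^ logStar (n : ℝ) :=
        le_mul_of_one_le_right (by linarith) (one_le_pow₀ (by norm_num))
  · rw [Fintype.card_fin]
    ring
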